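/- Let p ∈ ℂ, k ∈ ℕ, let ω be a cut-off function, and let F̃(z) = (−1)^k k!/(z − p)^{k+1} + g(z) be the meromorphic extension to ℂ \ {p} of the Mellin transform F(z) = ∫_0^∞ t^{z−p−1}(ln t)^k ω(t) dt (g entire). Then F̃ is rapidly decreasing on vertical lines, uniformly on strips: for every N ∈ ℕ and all real a ≤ b there exists C > 0 such that |F̃(β + iτ)| ≤ C (1 + |τ|)^{−N} for all β ∈ [a, b] and all τ ∈ ℝ with |τ| ≥ 1 + |Im p|. -/

import Mathlib

open MeasureTheory Set Complex

open Filter Topology Asymptotics in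
lemma aux_poly_isBigO (P : Polynomial ℂ) (c : ℝ) (hc : 0 < c) :
    (fun x : ℝ => P.eval (x : ℂ)) =O[atTop] (fun x : ℝ => Real.exp (c * x)) := by
  induction P using Polynomial.induction_on' with
  | add p q hp hq => simpa using hp.add hq
  | monomial n a =>
    have h := (isLittleO_pow_exp_pos_mul_atTop n hc).isBigO
    have h2 : (fun x : ℝ => (x : ℂ) ^ n) =O[atTop] (fun x : ℝ => Real.exp (c * x)) := by
      refine IsBigO.trans (IsBigO.of_norm_left ?_) h
      simp only [norm_pow, Complex.norm_real]
      simpa using (isBigO_refl (fun x : ℝ => x ^ n) atTop).norm_left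
    simpa using h2.const_mul_left a

open Filter Topology Asymptotics in
lemma aux_integrable (v : ℝ → ℂ) (hv : Continuous v) (A B : ℝ) (P : Polynomial ℂ)
    (hB : ∀ x < B, v x = 0) (hA : ∀ x > A, v x = P.eval (x : ℂ)) (s : ℂ) (hs : 0 < s.re) :
    Integrable (fun x : ℝ => cexp (-s * x) * v x) := by
  have h1 : IntegrableOn (fun x : ℝ => cexp (-s * x) * v x) (Ioi (B - 1)) := by
    have hcont : Continuous (fun x : ℝ => cexp (-s * x) * v x) := by fun_prop
    refine (integrable_norm_iff hcont.aestronglyMeasurable).1 ?_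
    refine integrable_of_isBigO_exp_neg (b := s.re / 2) (by positivity)
      hcont.norm.continuousOn ?_
    have h2 := aux_poly_isBigO P (s.re / 2) (by positivity)
    have h3 : v =O[atTop] (fun x : ℝ => Real.exp (s.re / 2 * x)) :=
      h2.congr' (by filter_upwards [eventually_gt_atTop A] with x hx using (hA x hx).symm)
        EventuallyEq.rfl
    have h4 : (fun x : ℝ => cexp (-s * x)) =O[atTop] (fun x : ℝ => Real.exp (-s.re * x)) := by
      refine IsBigO.of_norm_left ?_
      simp only [Complex.norm_exp]
      simpa using isBigO_refl (fun x : ℝ => Real.exp (-s.re * x)) atTop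
    refine (h4.mul h3).norm_left.congr_right ?_
    intro x
    rw [← Real.exp_add]
    ring_nf
  refine (integrableOn_iff_integrable_of_support_subset ?_).1 h1
  intro x hx
  by_contra h
  simp only [mem_Ioi, not_lt] at h
  exact hx (by simp [hB x (by linarith)])

lemma aux_parts (M : ℕ) : ∀ (v : ℝ → ℂ) (_ : ContDiff ℝ (⊤ : ℕ∞) v) (A B : ℝ) (P : Polynomial ℂ)
    (_ : ∀ x < B, v x = 0) (_ : ∀ x > A, v x = P.eval (x : ℂ)),
    ∃ w : ℝ → ℂ, Continuous w ∧ (∀ x < B, w x = 0) ∧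
      (∀ x > A, w x = (Polynomial.derivative^[M] P).eval (x : ℂ)) ∧
      ∀ s : ℂ, 0 < s.re →
      s ^ M * ∫ x : ℝ, cexp (-s * x) * v x = ∫ x : ℝ, cexp (-s * x) * w x := by
  induction M with
  | zero => intro v hv A B P hB hA; exact ⟨v, hv.continuous, hB, by simpa using hA, by simp⟩
  | succ M ih =>
    intro v hv A B P hB hA
    have hd : ContDiff ℝ (⊤ : ℕ∞) (deriv v) := by
      have := (contDiff_infty_iff_deriv (f := v)).1 hv
      exact this.2
    have hdiff : Differentiable ℝ v := (contDiff_infty_iff_deriv.1 hv).1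
    have hB' : ∀ x < B, deriv v x = 0 := by
      intro x hx
      have : v =ᶠ[nhds x] fun _ => 0 := by
        filter_upwards [Iio_mem_nhds hx] with y hy using hB y hy
      rw [this.deriv_eq]; simp
    have hA' : ∀ x > A, deriv v x = P.derivative.eval (x : ℂ) := by
      intro x hx
      have : v =ᶠ[nhds x] fun y : ℝ => P.eval (y : ℂ) := by
        filter_upwards [Ioi_mem_nhds hx] with y hy using hA y hy
      rw [this.deriv_eq]
      exact ((P.hasDerivAt (x : ℂ)).comp_ofReal).deriv
    obtain ⟨w, hw, h1, h2, h3⟩ := ih (deriv v) hd A B P.derivative hB' hA'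
    refine ⟨w, hw, h1, by simpa using h2, ?_⟩
    intro s hs
    rw [← h3 s hs, pow_succ, mul_assoc]
    congr 1
    have i0 := aux_integrable v hv.continuous A B P hB hA s hs
    have i1 := aux_integrable _ hd.continuous A B _ hB' hA' s hs
    have key := integral_mul_deriv_eq_deriv_mul_of_integrable
      (u := fun x : ℝ => cexp (-s * x)) (v := v)
      (u' := fun x : ℝ => cexp (-s * x) * (-s)) (v' := deriv v)
      (fun x _ => by
        have h := ((hasDerivAt_id (x : ℂ)).const_mul (-s)).cexp.comp_ofReal
        simpa using h)
      (fun x _ => (hdiff x).hasDerivAt) i1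
      (by
        refine (i0.const_mul (-s)).congr (Filter.Eventually.of_forall fun x => ?_)
        simp only [Pi.mul_apply]; ring) i0
    rw [key, ← integral_const_mul, ← integral_neg]
    congr 1; ext x; ring

lemma aux_entire (w : ℝ → ℂ) (hw : Continuous w) (hc : HasCompactSupport w) :
    Differentiable ℂ (fun s : ℂ => ∫ x : ℝ, cexp (-s * x) * w x) := by
  intro s₀
  have hint : ∀ f : ℝ → ℂ, Continuous f → Integrable (fun x => f x * w x) := by
    intro f hf
    exact (hf.mul hw).integrable_of_hasCompactSupport hc.mul_left
  refine (hasDerivAt_integral_of_dominated_loc_of_deriv_le (μ := volume)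
    (F' := fun s (x : ℝ) => (-(x : ℂ) * cexp (-s * x)) * w x)
    (bound := fun x : ℝ => ‖((|x| * Real.exp ((‖s₀‖ + 1) * |x|) : ℝ) : ℂ) * w x‖)
    (Metric.ball_mem_nhds s₀ one_pos) ?_ ?_ ?_ ?_ ?_ ?_).2.differentiableAt
  · exact Filter.Eventually.of_forall fun s => (hint _ (by fun_prop)).aestronglyMeasurable
  · exact hint _ (by fun_prop)
  · exact (hint _ (by fun_prop)).aestronglyMeasurable
  · refine Filter.Eventually.of_forall fun x s hs => ?_
    rw [norm_mul, norm_mul, norm_mul]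
    gcongr
    rw [Complex.norm_real, Real.norm_of_nonneg (by positivity), norm_neg, Complex.norm_real,
      Real.norm_eq_abs]
    gcongr
    refine (Complex.norm_exp_le_exp_norm _).trans ?_
    rw [norm_mul, norm_neg, Complex.norm_real, Real.norm_eq_abs]
    gcongr
    have h1 : ‖s - s₀‖ < 1 := by simpa [dist_eq_norm] using hs
    have h2 := norm_add_le (s - s₀) s₀
    rw [sub_add_cancel] at h2
    linarith
  · exact (hint _ (by fun_prop)).norm
  · refine Filter.Eventually.of_forall fun x s _ => ?_
    have h := (((hasDerivAt_id s).neg.mul_const (x : ℂ)).cexp).mul_const (w x)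
    refine h.congr_deriv ?_
    simp only [Pi.neg_apply, id]
    ring

lemma aux_bound (w : ℝ → ℂ) (hw : Continuous w) (hc : HasCompactSupport w) (R : ℝ) :
    ∃ K > (0 : ℝ), ∀ s : ℂ, |s.re| ≤ R → ‖∫ x : ℝ, cexp (-s * x) * w x‖ ≤ K := by
  have hi : Integrable (fun x : ℝ => Real.exp (R * |x|) * ‖w x‖) := by
    refine Continuous.integrable_of_hasCompactSupport (by fun_prop) ?_
    exact hc.norm.mul_left
  refine ⟨(∫ x : ℝ, Real.exp (R * |x|) * ‖w x‖) + 1, ?_, ?_⟩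
  · have : 0 ≤ ∫ x : ℝ, Real.exp (R * |x|) * ‖w x‖ := integral_nonneg fun x => by positivity
    linarith
  · intro s hs
    refine (norm_integral_le_of_norm_le hi (Filter.Eventually.of_forall fun x => ?_)).trans
      (by linarith)
    rw [norm_mul, Complex.norm_exp]
    gcongr
    have : (-s * (x : ℂ)).re = -(s.re * x) := by simp
    rw [this]
    calc -(s.re * x) ≤ |s.re * x| := neg_le_abs _
      _ = |s.re| * |x| := abs_mul _ _
      _ ≤ R * |x| := by gcongr

lemma aux_cov (f : ℝ → ℂ) :
    ∫ t in Ioi (0 : ℝ), f t = ∫ x : ℝ, (Real.exp (-x) : ℂ) * f (Real.exp (-x)) := by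
  have himg : (fun x : ℝ => Real.exp (-x)) '' univ = Ioi 0 := by
    ext y
    constructor
    · rintro ⟨x, _, rfl⟩; exact Real.exp_pos _
    · intro hy; exact ⟨-Real.log y, trivial, by simp [Real.exp_log hy]⟩
  have h := integral_image_eq_integral_abs_deriv_smul (s := univ)
    (f := fun x : ℝ => Real.exp (-x)) (f' := fun x => Real.exp (-x) * (-1)) MeasurableSet.univ
    (fun x _ => ((hasDerivAt_id x).neg.exp).hasDerivWithinAt)
    (fun x _ y _ hxy => by simpa using hxy) f
  rw [himg] at h
  rw [h, setIntegral_univ]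
  congr 1; ext x
  simp [abs_of_pos (Real.exp_pos _)]



/-- The meromorphic extension
`F̃(z) = (−1)^k k!/(z−p)^(k+1) + g(z)` (with `g` entire) of the Mellin transform
`F(z) = ∫_0^∞ t^(z−p−1) (ln t)^k ω(t) dt` of `t ↦ t^(−p) (ln t)^k ω(t)` is
rapidly decreasing on vertical lines, uniformly on strips: for every `N` and
`a ≤ b` there is `C > 0` with `|F̃(β+iτ)| ≤ C (1+|τ|)^(−N)` for all `β ∈ [a,b]`
and `|τ| ≥ 1 + |Im p|`. -/
theorem mellin_cutoff_log_power_rapid_decay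
    (p : ℂ) (k : ℕ) (ω : ℝ → ℝ)
    (hω_smooth : ContDiffOn ℝ (⊤ : ℕ∞) ω (Ici (0 : ℝ)))
    (hω_nonneg : ∀ t, 0 ≤ t → 0 ≤ ω t) (hω_le_one : ∀ t, 0 ≤ t → ω t ≤ 1)
    (hω_one : ∃ ε > (0 : ℝ), ∀ t, 0 ≤ t → t < ε → ω t = 1)
    (hω_zero : ∃ T : ℝ, ∀ t, T ≤ t → ω t = 0)
    (g : ℂ → ℂ) (hg : Differentiable ℂ g)
    (hF : ∀ z : ℂ, p.re < z.re →
      (∫ t in Ioi (0 : ℝ), (t : ℂ) ^ (z - p - 1) * (Real.log t : ℂ) ^ k * (ω t : ℂ)) =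
        (-1) ^ k * (Nat.factorial k : ℂ) / (z - p) ^ (k + 1) + g z) :
    ∀ N : ℕ, ∀ a b : ℝ, a ≤ b → ∃ C > (0 : ℝ),
      ∀ β ∈ Icc a b, ∀ τ : ℝ, 1 + |p.im| ≤ |τ| →
        ‖(-1 : ℂ) ^ k * (Nat.factorial k : ℂ) / ((β + τ * I : ℂ) - p) ^ (k + 1) +
            g (β + τ * I)‖ ≤ C / (1 + |τ|) ^ N := by

  intro N a b hab
  obtain ⟨ε, hε, hone⟩ := hω_one
  obtain ⟨T, hT⟩ := hω_zero
  set v : ℝ → ℂ := fun x => (-(x : ℂ)) ^ k * (ω (Real.exp (-x)) : ℂ) with hvdef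
  have hv : ContDiff ℝ (⊤ : ℕ∞) v := by
    have h1 : ContDiff ℝ (⊤ : ℕ∞) (fun x : ℝ => ω (Real.exp (-x))) := by
      rw [← contDiffOn_univ]
      exact hω_smooth.comp (Real.contDiff_exp.comp contDiff_neg).contDiffOn
        (fun x _ => (Real.exp_pos _).le)
    have h2 : ContDiff ℝ (⊤ : ℕ∞) (fun x : ℝ => (x : ℂ)) := Complex.ofRealCLM.contDiff
    exact (h2.neg.pow k).mul (Complex.ofRealCLM.contDiff.comp h1)
  have hB : ∀ x < -Real.log (max T 1), v x = 0 := by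
    intro x hx
    have : T ≤ Real.exp (-x) := by
      refine (le_max_left T 1).trans ?_
      rw [← Real.log_le_iff_le_exp (by positivity)]
      linarith
    simp [hvdef, hT _ this]
  have hA : ∀ x > -Real.log ε, v x = ((-Polynomial.X : Polynomial ℂ) ^ k).eval (x : ℂ) := by
    intro x hx
    have : Real.exp (-x) < ε := by
      rw [← Real.lt_log_iff_exp_lt hε]; linarith
    simp [hvdef, hone _ (Real.exp_pos _).le this]
  obtain ⟨w, hw, hwB, hwA, hwI⟩ := aux_parts (N + k + 1) v hv _ _ _ hB hA
  have hc : HasCompactSupport w := by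
    refine HasCompactSupport.intro (isCompact_Icc (a := -Real.log (max T 1)) (b := -Real.log ε)) ?_
    intro x hx
    by_cases h : x < -Real.log (max T 1)
    · exact hwB x h
    · have h' : x > -Real.log ε := by
        by_contra h2
        exact hx ⟨not_lt.1 h, not_lt.1 h2⟩
      rw [hwA x h', Polynomial.iterate_derivative_eq_zero, Polynomial.eval_zero]
      have : ((-Polynomial.X : Polynomial ℂ) ^ k).natDegree ≤ k := by
        refine Polynomial.natDegree_pow_le.trans ?_
        simp
      omega
  have hH := aux_entire w hw hc
  set H : ℂ → ℂ := fun s : ℂ => ∫ x : ℝ, cexp (-s * x) * w x with hHdef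
  -- identity
  set L : ℂ → ℂ := fun z => (z - p) ^ (N + k + 1) *
    ((-1) ^ k * (Nat.factorial k : ℂ) / (z - p) ^ (k + 1) + g z) with hL
  set L' : ℂ → ℂ := fun z => (z - p) ^ N * ((-1) ^ k * (Nat.factorial k : ℂ)) +
    (z - p) ^ (N + k + 1) * g z with hL'
  have hLL : ∀ z, z ≠ p → L z = L' z := by
    intro z hz
    have : z - p ≠ 0 := sub_ne_zero.2 hz
    simp only [hL, hL']
    rw [mul_add]
    congr 1
    rw [add_assoc, pow_add]
    field_simp
  have hhalf : ∀ z : ℂ, p.re < z.re → L z = H (z - p) := by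
    intro z hz
    simp only [hL, hHdef]
    rw [← hF z hz, ← hwI (z - p) (by simpa using hz), aux_cov]
    congr 2
    ext x
    have hne : ((Real.exp (-x) : ℝ) : ℂ) ≠ 0 := by exact_mod_cast (Real.exp_pos _).ne'
    rw [Real.log_exp, Complex.cpow_sub _ _ hne, Complex.cpow_one,
      Complex.cpow_def_of_ne_zero hne, ← Complex.ofReal_log (Real.exp_pos _).le, Real.log_exp]
    simp only [hvdef]
    rw [mul_assoc, ← mul_assoc, mul_div_cancel₀ _ hne]
    push_cast
    congr 2
    ring
  have hid : L' = fun z => H (z - p) := by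
    refine AnalyticOnNhd.eq_of_eventuallyEq (𝕜 := ℂ) (z₀ := p + 1) ?_ ?_ ?_
    · refine (Differentiable.differentiableOn ?_).analyticOnNhd isOpen_univ
      simp only [hL']
      fun_prop
    · refine (Differentiable.differentiableOn ?_).analyticOnNhd isOpen_univ
      exact hH.comp (by fun_prop : Differentiable ℂ fun z => z - p)
    · have : {z : ℂ | p.re < z.re} ∈ nhds (p + 1) :=
        (isOpen_lt continuous_const Complex.continuous_re).mem_nhds (by simp)
      filter_upwards [this] with z hz
      have hz' : z ≠ p := by rintro rfl; exact lt_irrefl _ hz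
      rw [← hLL z hz', hhalf z hz]
  obtain ⟨K, hK, hbd⟩ := aux_bound w hw hc (max |a| |b| + |p.re|)
  refine ⟨K * (2 + |p.im|) ^ N, by positivity, ?_⟩
  intro β hβ τ hτ
  set z : ℂ := (β + τ * I : ℂ) with hz
  have hre : z.re = β := by simp [hz]
  have him : z.im = τ := by simp [hz]
  have hs : |τ| - |p.im| ≤ ‖z - p‖ := by
    have h1 := Complex.abs_im_le_norm (z - p)
    rw [Complex.sub_im, him] at h1
    exact (abs_sub_abs_le_abs_sub _ _).trans h1
  have hs1 : 1 ≤ ‖z - p‖ := by linarith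
  have hzp : z ≠ p := by
    rintro h
    rw [h] at hs1; simp at hs1; linarith
  have hsz : 1 + |τ| ≤ (2 + |p.im|) * ‖z - p‖ := by
    have := abs_nonneg p.im
    nlinarith
  have e1 : L z = H (z - p) := by rw [hLL z hzp, hid]
  have e2 : ‖H (z - p)‖ ≤ K := by
    refine hbd _ ?_
    rw [Complex.sub_re, hre]
    refine (abs_sub _ _).trans ?_
    gcongr
    exact abs_le_max_abs_abs hβ.1 hβ.2
  rw [← e1] at e2
  simp only [hL] at e2
  rw [norm_mul, norm_pow] at e2
  set X := ‖(-1 : ℂ) ^ k * (Nat.factorial k : ℂ) / (z - p) ^ (k + 1) + g z‖ with hX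
  rw [le_div_iff₀ (by positivity)]
  have e3 : ‖z - p‖ ^ N ≤ ‖z - p‖ ^ (N + k + 1) := pow_le_pow_right₀ hs1 (by omega)
  have hX0 : 0 ≤ X := norm_nonneg _
  calc X * (1 + |τ|) ^ N ≤ X * ((2 + |p.im|) * ‖z - p‖) ^ N := by gcongr
    _ = (‖z - p‖ ^ N * X) * (2 + |p.im|) ^ N := by rw [mul_pow]; ring
    _ ≤ (‖z - p‖ ^ (N + k + 1) * X) * (2 + |p.im|) ^ N := by gcongr
    _ ≤ K * (2 + |p.im|) ^ N := by gcongr
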